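/- Let λ and x be real numbers and let n, r be nonnegative integers. Then ∑_{k=0}^{n} (−1)^k · C(x, k) · (k)_{r,λ} = ∑_{j=0}^{r} (−1)^j · C(n−x, n−j) · C(x, j) · j! · {r brace j}_λ, where all binomial coefficients with real upper arguments are generalized binomial coefficients. -/

import Mathlib

/-- The degenerate falling factorial `(x)_{n,λ} = x(x-λ)⋯(x-(n-1)λ)`. -/
noncomputable def dff (lam x : ℝ) (n : ℕ) : ℝ := ∏ i ∈ Finset.range n, (x - i * lam)

/-- The degenerate Stirling number of the second kind
`{n brace k}_λ = (1/k!) ∑_{j=0}^{k} C(k,j) (-1)^{k-j} (j)_{n,λ}`. -/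
noncomputable def dstirling (lam : ℝ) (n k : ℕ) : ℝ :=
  (1 / (k.factorial : ℝ)) *
    ∑ j ∈ Finset.range (k + 1), (k.choose j : ℝ) * (-1) ^ (k - j) * dff lam (j : ℝ) n

/-- The generalized binomial coefficient `C(x,m) = x(x-1)⋯(x-m+1)/m!` with real upper argument. -/
noncomputable def gchoose (x : ℝ) (m : ℕ) : ℝ := (∏ i ∈ Finset.range m, (x - i)) / m.factorial

/-- Generalized binomial coefficient with integer lower argument; zero when the lower
argument is negative. -/
noncomputable def gchooseZ (x : ℝ) (m : ℤ) : ℝ := if 0 ≤ m then gchoose x m.toNat else 0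

theorem dff_eq_polynomial_eval (lam : ℝ) (r : ℕ) :
    (fun x => dff lam x r) =
      (∏ i ∈ Finset.range r, (Polynomial.X - Polynomial.C (i * lam))).eval := by
  funext x
  simp [dff, Polynomial.eval_prod]

theorem fwdDiff_iter_dff_zero (lam : ℝ) (r j : ℕ) :
    (fwdDiff (1 : ℝ))^[j] (fun x => dff lam x r) 0 = j.factorial * dstirling lam r j := by
  rw [fwdDiff_iter_eq_sum_shift, dstirling, ← mul_assoc, mul_one_div_cancel (by positivity),
    one_mul]
  refine Finset.sum_congr rfl fun k _ => ?_
  rw [zsmul_eq_mul]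
  push_cast
  rw [zero_add, nsmul_one]
  ring

theorem dstirling_eq_zero_of_lt (lam : ℝ) {r j : ℕ} (h : r < j) : dstirling lam r j = 0 := by
  have hΔ := fwdDiff_iter_dff_zero lam r j
  rw [dff_eq_polynomial_eval, Polynomial.fwdDiff_iter_eq_zero_of_degree_lt] at hΔ
  · have hj : (j.factorial : ℝ) ≠ 0 := by positivity
    simpa [hj] using hΔ.symm
  · rwa [Polynomial.natDegree_finsetProd_X_sub_C_eq_card, Finset.card_range]

/-- Newton's expansion of the degenerate falling factorial at a natural number. -/
theorem dff_natCast_eq_sum (lam : ℝ) (k r : ℕ) :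
    dff lam k r =
      ∑ j ∈ Finset.range (r + 1), (k.choose j : ℝ) * (j.factorial * dstirling lam r j) := by
  have newton := shift_eq_sum_fwdDiff_iter (1 : ℝ) (fun x => dff lam x r) k 0
  simp only [fwdDiff_iter_dff_zero, zero_add, nsmul_eq_mul, mul_one] at newton
  rw [newton]
  trans ∑ j ∈ Finset.range (max k r + 1), (k.choose j : ℝ) * (j.factorial * dstirling lam r j)
  · refine Finset.sum_subset (Finset.range_subset_range.2 (by omega)) fun j _ hj => ?_
    have hlt : k < j := by rw [Finset.mem_range] at hj; omega
    rw [Nat.choose_eq_zero_of_lt hlt]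
    simp
  · refine (Finset.sum_subset (Finset.range_subset_range.2 (by omega)) fun j _ hj => ?_).symm
    have hlt : r < j := by rw [Finset.mem_range] at hj; omega
    rw [dstirling_eq_zero_of_lt lam hlt]
    simp

theorem gchoose_add_mul_choose (x : ℝ) (j m : ℕ) :
    gchoose x (j + m) * ((j + m).choose j : ℝ) = gchoose x j * gchoose (x - j) m := by
  have hprod : ∏ i ∈ Finset.range m, (x - ((j + i : ℕ) : ℝ)) =
      ∏ i ∈ Finset.range m, (x - j - i) :=
    Finset.prod_congr rfl fun i _ => by push_cast; ring
  rw [gchoose, gchoose, gchoose, Finset.prod_range_add, hprod, Nat.cast_add_choose]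
  field_simp

theorem neg_one_pow_mul_gchoose (y : ℝ) (m : ℕ) :
    (-1) ^ m * gchoose y m = gchoose (m - 1 - y) m := by
  rw [gchoose, gchoose, ← mul_div_assoc,
    ← Finset.prod_range_reflect (fun i : ℕ => (m - 1 - y - i : ℝ))]
  congr 1
  rw [← Finset.card_range m, ← Finset.prod_const, Finset.card_range, ← Finset.prod_mul_distrib]
  refine Finset.prod_congr rfl fun i hi => ?_
  rw [Nat.sub_sub, Nat.cast_sub (by have := Finset.mem_range.1 hi; omega)]
  push_cast
  ring

theorem gchoose_add_one (y : ℝ) (m : ℕ) :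
    gchoose (y + 1) (m + 1) = gchoose y m + gchoose y (m + 1) := by
  have hprod : ∏ i ∈ Finset.range m, (y + 1 - ((i + 1 : ℕ) : ℝ)) =
      ∏ i ∈ Finset.range m, (y - i) :=
    Finset.prod_congr rfl fun i _ => by push_cast; ring
  rw [gchoose, gchoose, gchoose, Finset.prod_range_succ', hprod, Finset.prod_range_succ,
    Nat.factorial_succ]
  push_cast
  field_simp
  ring

theorem sum_neg_one_pow_mul_gchoose (y : ℝ) (m : ℕ) :
    ∑ i ∈ Finset.range (m + 1), (-1) ^ i * gchoose y i = gchoose (m - y) m := by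
  induction m with
  | zero => simp [gchoose]
  | succ m ih =>
    rw [Finset.sum_range_succ, ih, neg_one_pow_mul_gchoose]
    have h := gchoose_add_one (m - y) m
    push_cast
    rw [show (m : ℝ) + 1 - 1 - y = m - y by ring, show (m : ℝ) + 1 - y = m - y + 1 by ring, h]

theorem sum_neg_one_pow_mul_gchoose_mul_choose (x : ℝ) (n j : ℕ) :
    ∑ k ∈ Finset.range (n + 1), (-1) ^ k * gchoose x k * (k.choose j : ℝ) =
      (-1) ^ j * gchooseZ (n - x) ((n : ℤ) - j) * gchoose x j := by
  have hlow : ∀ k < j, (-1) ^ k * gchoose x k * (k.choose j : ℝ) = 0 := fun k hk => by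
    rw [Nat.choose_eq_zero_of_lt hk]
    simp
  rcases lt_or_ge n j with h | h
  · rw [gchooseZ, if_neg (by omega), Finset.sum_eq_zero fun k hk => hlow k (by
      have := Finset.mem_range.1 hk; omega)]
    simp
  · obtain ⟨m, rfl⟩ := Nat.exists_eq_add_of_le h
    rw [gchooseZ, if_pos (by omega), show (((j + m : ℕ) : ℤ) - j).toNat = m by omega, add_assoc,
      Finset.sum_range_add, Finset.sum_eq_zero fun k hk => hlow k (Finset.mem_range.1 hk),
      zero_add, show ((j + m : ℕ) : ℝ) - x = m - (x - j) by push_cast; ring,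
      ← sum_neg_one_pow_mul_gchoose, Finset.mul_sum, Finset.sum_mul]
    refine Finset.sum_congr rfl fun i _ => ?_
    rw [mul_assoc, gchoose_add_mul_choose, pow_add]
    ring

theorem alternating_sum_gchoose_dff (lam x : ℝ) (n r : ℕ) :
    ∑ k ∈ Finset.range (n + 1), (-1 : ℝ) ^ k * gchoose x k * dff lam (k : ℝ) r =
      ∑ j ∈ Finset.range (r + 1),
        (-1 : ℝ) ^ j * gchooseZ ((n : ℝ) - x) ((n : ℤ) - (j : ℤ)) * gchoose x j *
          (j.factorial : ℝ) * dstirling lam r j := by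
  simp_rw [dff_natCast_eq_sum lam _ r, Finset.mul_sum]
  rw [Finset.sum_comm]
  refine Finset.sum_congr rfl fun j _ => ?_
  rw [← sum_neg_one_pow_mul_gchoose_mul_choose, mul_assoc, Finset.sum_mul]
  exact Finset.sum_congr rfl fun k _ => (mul_assoc _ _ _).symm
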